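/- arXiv:2401.13612 — 9 statements merged into one kernel-verified Lean document; each statement's English description precedes it below -/
import Mathlib

section
/- Let v_i, v_{i+1} be positive reals, r_i, r_{i+1} nonnegative reals, and y_{i−1}, y_i, y_{i+1} reals. Define the traversing times e_i = (y_i − y_{i−1} − 2 r_i)/v_i and e_{i+1} = (y_{i+1} − y_i − 2 r_{i+1})/v_{i+1}, let y' = (v_{i+1}(y_{i−1} + 2 r_i) + v_i(y_{i+1} − 2 r_{i+1}))/(v_i + v_{i+1}) be the updated boundary, and define the updated traversing times e_i' = (y' − y_{i−1} − 2 r_i)/v_i and e_{i+1}' = (y_{i+1} − y' − 2 r_{i+1})/v_{i+1}. Then, with ε = v_i v_{i+1}/(v_i + v_{i+1}), one has e_i' = e_i + (ε/v_i)(e_{i+1} − e_i) and e_{i+1}' = e_{i+1} − (ε/v_{i+1})(e_{i+1} − e_i); i.e. the geometric boundary update is equivalent to a weighted-consensus update on traversing times. -/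
/-- The geometric boundary update is a weighted-consensus update on
the traversing times (eq. (14) of the paper). -/
theorem meeting_update_is_weighted_consensus
    (vi vi1 : ℝ) (ri ri1 : ℝ) (ym yi yp : ℝ)
    (hvi : 0 < vi) (hvi1 : 0 < vi1) (hri : 0 ≤ ri) (hri1 : 0 ≤ ri1) :
    ((vi1 * (ym + 2 * ri) + vi * (yp - 2 * ri1)) / (vi + vi1) - ym - 2 * ri) / vi =
      (yi - ym - 2 * ri) / vi +
        ((vi * vi1 / (vi + vi1)) / vi) *
          ((yp - yi - 2 * ri1) / vi1 - (yi - ym - 2 * ri) / vi) ∧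
    (yp - (vi1 * (ym + 2 * ri) + vi * (yp - 2 * ri1)) / (vi + vi1) - 2 * ri1) / vi1 =
      (yp - yi - 2 * ri1) / vi1 -
        ((vi * vi1 / (vi + vi1)) / vi1) *
          ((yp - yi - 2 * ri1) / vi1 - (yi - ym - 2 * ri) / vi) := by
  have hsum : vi + vi1 ≠ 0 := (add_pos hvi hvi1).ne'
  constructor
  · field_simp
    ring
  · field_simp
    ring
end

section
/- Fix n ≥ 2 and speeds v_1,…,v_n > 0. For each link index j ∈ {1,…,n−1} let P_j be the n×n real matrix equal to the identity except in rows j and j+1, where [P_j]_{j,j} = v_j/(v_j+v_{j+1}), [P_j]_{j,j+1} = v_{j+1}/(v_j+v_{j+1}), [P_j]_{j+1,j} = v_j/(v_j+v_{j+1}), [P_j]_{j+1,j+1} = v_{j+1}/(v_j+v_{j+1}). Let σ : ℕ → {1,…,n−1} be a sequence in which every link index appears infinitely often. Then for every initial vector e(0) ∈ ℝⁿ, the iterates e(k+1) = P_{σ(k)} e(k) converge, as k → ∞, to c·(1,1,…,1), where c = (Σ_{j=1}^n v_j e_j(0)) / (Σ_{j=1}^n v_j): all entries converge to the v-weighted average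 of the initial entries. -/
open Matrix Filter

/-- The Perron matrix `P_j` of the weighted-consensus update along link
`(j, j+1)` for speeds `v`: the identity except in rows `j` and `j+1`, which both
equal `(…, v_j/(v_j+v_{j+1}), v_{j+1}/(v_j+v_{j+1}), …)` on columns `j, j+1`. -/
noncomputable def perronMatrix {n : ℕ} (v : Fin n → ℝ) (j : Fin (n - 1)) :
    Matrix (Fin n) (Fin n) ℝ :=
  let a : Fin n := ⟨(j : ℕ), lt_of_lt_of_le j.isLt (Nat.sub_le n 1)⟩
  let b : Fin n := ⟨(j : ℕ) + 1, by have h := j.isLt; omega⟩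
  Matrix.of fun p q =>
    if p = a ∨ p = b then
      if q = a then v a / (v a + v b)
      else if q = b then v b / (v a + v b)
      else 0
    else if p = q then 1 else 0

/-- An orbit of finitely many nonexpansive maps, each applied infinitely often in an arbitrary
order, converges to a common fixed point as soon as its steps tend to zero and a common fixed
point exists. -/
theorem exists_tendsto_common_fixedPoint {X ι : Type*} [MetricSpace X] [ProperSpace X] [Finite ι]
    {T : ι → X → X} (hT : ∀ j x y, dist (T j x) (T j y) ≤ dist x y) {p : X} (hp : ∀ j, T j p = p)
    {σ : ℕ → ι} (hσ : ∀ j N, ∃ k, N ≤ k ∧ σ k = j)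
    {x : ℕ → X} (hx : ∀ k, x (k + 1) = T (σ k) (x k))
    (hstep : Tendsto (fun k => dist (x (k + 1)) (x k)) atTop (nhds 0)) :
    ∃ z, (∀ j, T j z = z) ∧ Tendsto x atTop (nhds z) := by
  have hbdd : ∀ k, x k ∈ Metric.closedBall p (dist (x 0) p) := by
    intro k
    induction k with
    | zero => simp
    | succ k ih =>
      rw [Metric.mem_closedBall, hx] at *
      exact ((hp (σ k)) ▸ hT (σ k) (x k) p).trans ih
  obtain ⟨z, -, φ, hφ, hz⟩ := tendsto_subseq_of_bounded Metric.isBounded_closedBall hbdd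
  have hfix : ∀ j, T j z = z := by
    by_contra! ⟨j₀, hj₀⟩
    obtain ⟨j₁, hj₁, hmin⟩ := Set.exists_min_image {j | T j z ≠ z} (fun j => dist (T j z) z)
      (Set.toFinite _) ⟨j₀, hj₀⟩
    have hδ : 0 < dist (T j₁ z) z := dist_pos.2 hj₁
    set δ := dist (T j₁ z) z
    obtain ⟨m, hm, hmz⟩ := ((hφ.tendsto_atTop.eventually
      (eventually_forall_ge_atTop.2 (hstep.eventually_lt_const (half_pos hδ)))).and
      ((tendsto_iff_dist_tendsto_zero.1 hz).eventually_lt_const (by positivity : 0 < δ / 4))).exists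
    have hex : ∃ l, φ m ≤ l ∧ T (σ l) z ≠ z := by
      obtain ⟨l, hl, rfl⟩ := hσ j₀ (φ m)
      exact ⟨l, hl, hj₀⟩
    classical
    obtain ⟨hl, hTl⟩ := Nat.find_spec hex
    have hclose : ∀ i, φ m ≤ i → i ≤ Nat.find hex → dist (x i) z ≤ dist (x (φ m)) z := by
      intro i hi
      induction i, hi using Nat.le_induction with
      | base => simp
      | succ i hi ih =>
        intro hlt
        have hfixed : T (σ i) z = z := by
          by_contra h
          exact Nat.find_min hex hlt ⟨hi, h⟩
        have := hT (σ i) (x i) z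
        rw [hfixed, ← hx] at this
        exact this.trans (ih (Nat.le_of_succ_le hlt))
    set l := Nat.find hex
    have h₁ := hmin (σ l) hTl
    have h₂ := hclose l hl le_rfl
    have h₃ := hm l hl
    have h₄ := hT (σ l) z (x l)
    rw [hx] at h₃
    have h₅ := dist_triangle4 (T (σ l) z) (T (σ l) (x l)) (x l) z
    rw [dist_comm z] at h₄
    simp only [Function.comp_apply] at hmz
    linarith
  refine ⟨z, hfix, tendsto_iff_dist_tendsto_zero.2 ?_⟩
  have hanti : Antitone fun k => dist (x k) z := antitone_nat_of_succ_le fun k => by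
    simpa only [hx, hfix] using hT (σ k) (x k) z
  exact (tendsto_iff_tendsto_subseq_of_antitone hanti hφ.tendsto_atTop).2
    (tendsto_iff_dist_tendsto_zero.1 hz)

/-- The first endpoint of the link `(j, j+1)`. -/
def linkFst {n : ℕ} (j : Fin (n - 1)) : Fin n := ⟨j, by omega⟩

/-- The second endpoint of the link `(j, j+1)`. -/
def linkSnd {n : ℕ} (j : Fin (n - 1)) : Fin n := ⟨j + 1, by omega⟩

theorem linkFst_ne_linkSnd {n : ℕ} (j : Fin (n - 1)) : linkFst j ≠ linkSnd j := by
  simp [linkFst, linkSnd]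

theorem perronMatrix_mulVec_apply {n : ℕ} (v : Fin n → ℝ) (j : Fin (n - 1)) (y : Fin n → ℝ) (i : Fin n) :
    (perronMatrix v j *ᵥ y) i =
      if i = linkFst j ∨ i = linkSnd j then
        (v (linkFst j) * y (linkFst j) + v (linkSnd j) * y (linkSnd j)) /
          (v (linkFst j) + v (linkSnd j))
      else y i := by
  have hne := linkFst_ne_linkSnd j
  change ∑ q, (if i = linkFst j ∨ i = linkSnd j then
      if q = linkFst j then v (linkFst j) / (v (linkFst j) + v (linkSnd j))
      else if q = linkSnd j then v (linkSnd j) / (v (linkFst j) + v (linkSnd j)) else 0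
    else if i = q then 1 else 0) * y q = _
  split_ifs with h
  · rw [Fintype.sum_eq_add _ _ hne fun q hq => by simp [hq.1, hq.2]]
    simp only [if_true, if_neg hne.symm]
    ring
  · simp

/-- The displacement of the update is orthogonal, in the `v`-weighted inner product, to the
vectors that agree on the two endpoints of the link. -/
theorem sum_mul_sub_perronMatrix_mulVec {n : ℕ} {v : Fin n → ℝ} (hv : ∀ i, 0 < v i)
    (j : Fin (n - 1)) (y : Fin n → ℝ)
    {f : Fin n → ℝ} (hf : f (linkFst j) = f (linkSnd j)) :
    ∑ i, v i * f i * (y i - (perronMatrix v j *ᵥ y) i) = 0 := by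
  have hpos := add_pos (hv (linkFst j)) (hv (linkSnd j))
  rw [Fintype.sum_eq_add _ _ (linkFst_ne_linkSnd j) fun q hq => by
    simp [perronMatrix_mulVec_apply, hq.1, hq.2]]
  simp only [perronMatrix_mulVec_apply, true_or, or_true, if_true, hf]
  field_simp
  ring

theorem sum_mul_perronMatrix_mulVec {n : ℕ} {v : Fin n → ℝ} (hv : ∀ i, 0 < v i)
    (j : Fin (n - 1)) (y : Fin n → ℝ) :
    ∑ i, v i * (perronMatrix v j *ᵥ y) i = ∑ i, v i * y i := by
  have h := sum_mul_sub_perronMatrix_mulVec hv j y (f := 1) rfl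
  simp only [Pi.one_apply, mul_one, mul_sub, Finset.sum_sub_distrib] at h
  linarith

/-- Pythagoras' identity for the update, an orthogonal projection in the `v`-weighted inner
product. -/
theorem sum_mul_sq_perronMatrix_mulVec {n : ℕ} {v : Fin n → ℝ} (hv : ∀ i, 0 < v i)
    (j : Fin (n - 1)) (y : Fin n → ℝ) :
    ∑ i, v i * ((perronMatrix v j *ᵥ y) i - y i) ^ 2 =
      ∑ i, v i * y i ^ 2 - ∑ i, v i * (perronMatrix v j *ᵥ y) i ^ 2 := by
  have h := sum_mul_sub_perronMatrix_mulVec hv j y (f := perronMatrix v j *ᵥ y)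
    (by simp [perronMatrix_mulVec_apply])
  rw [← Finset.sum_sub_distrib, ← sub_eq_zero, ← Finset.sum_sub_distrib,
    ← mul_zero (-2 : ℝ), ← h, Finset.mul_sum]
  exact Finset.sum_congr rfl fun i _ => by ring

theorem dist_perronMatrix_mulVec_le {n : ℕ} {v : Fin n → ℝ} (hv : ∀ i, 0 < v i)
    (j : Fin (n - 1)) (x y : Fin n → ℝ) :
    dist (perronMatrix v j *ᵥ x) (perronMatrix v j *ᵥ y) ≤ dist x y := by
  refine (dist_pi_le_iff dist_nonneg).2 fun i => ?_
  rw [perronMatrix_mulVec_apply, perronMatrix_mulVec_apply]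
  split_ifs
  · have ha := hv (linkFst j)
    have hb := hv (linkSnd j)
    have h₁ := abs_le.1 (dist_le_pi_dist x y (linkFst j))
    have h₂ := abs_le.1 (dist_le_pi_dist x y (linkSnd j))
    rw [Real.dist_eq, ← sub_div, abs_div, abs_of_pos (add_pos ha hb),
      div_le_iff₀ (add_pos ha hb), abs_le]
    constructor <;> nlinarith
  · exact dist_le_pi_dist x y i

theorem tendsto_dist_perronMatrix_orbit {n : ℕ} {v : Fin n → ℝ} (hv : ∀ i, 0 < v i)
    {σ : ℕ → Fin (n - 1)} {e : ℕ → Fin n → ℝ}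
    (he : ∀ k, e (k + 1) = perronMatrix v (σ k) *ᵥ e k) :
    Tendsto (fun k => dist (e (k + 1)) (e k)) atTop (nhds 0) := by
  have hdrop : ∀ k, ∑ i, v i * (e (k + 1) i - e k i) ^ 2 =
      ∑ i, v i * e k i ^ 2 - ∑ i, v i * e (k + 1) i ^ 2 := fun k => by
    rw [he, sum_mul_sq_perronMatrix_mulVec hv]
  have hnonneg : ∀ y : Fin n → ℝ, ∀ i, 0 ≤ v i * y i ^ 2 := fun y i =>
    mul_nonneg (hv i).le (sq_nonneg _)
  have hanti : Antitone fun k => ∑ i, v i * e k i ^ 2 := antitone_nat_of_succ_le fun k => by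
    rw [← sub_nonneg, ← hdrop]
    exact Finset.sum_nonneg fun i _ => hnonneg (e (k + 1) - e k) i
  have hlim := tendsto_atTop_ciInf hanti
    ⟨0, Set.forall_mem_range.2 fun k => Finset.sum_nonneg fun i _ => hnonneg (e k) i⟩
  have hdiff := hlim.sub (hlim.comp (tendsto_add_atTop_nat 1))
  simp only [Function.comp_apply, ← hdrop, sub_self] at hdiff
  have hcoord : Tendsto (fun k => e (k + 1) - e k) atTop (nhds 0) := by
    refine tendsto_pi_nhds.2 fun i => ?_
    have hterm : Tendsto (fun k => v i * (e (k + 1) i - e k i) ^ 2) atTop (nhds 0) :=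
      squeeze_zero (fun k => hnonneg (e (k + 1) - e k) i) (fun k =>
        Finset.single_le_sum (fun i _ => hnonneg (e (k + 1) - e k) i) (Finset.mem_univ i)) hdiff
    have hsq : Tendsto (fun k => (e (k + 1) i - e k i) ^ 2) atTop (nhds 0) := by
      simpa [(hv i).ne'] using hterm.const_mul (v i)⁻¹
    simpa [Real.sqrt_sq_eq_abs, tendsto_zero_iff_abs_tendsto_zero, Function.comp_def]
      using hsq.sqrt
  simpa [dist_eq_norm] using hcoord.norm

theorem eq_of_perronMatrix_mulVec_eq {n : ℕ} {v : Fin n → ℝ} {z : Fin n → ℝ}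
    (hz : ∀ j, perronMatrix v j *ᵥ z = z) (i i' : Fin n) : z i = z i' := by
  have hlink : ∀ j : Fin (n - 1), z (linkFst j) = z (linkSnd j) := fun j => by
    rw [← hz j]
    simp [perronMatrix_mulVec_apply]
  have hzero : ∀ k (hk : k < n), z ⟨k, hk⟩ = z ⟨0, by omega⟩ := by
    intro k hk
    induction k with
    | zero => rfl
    | succ k ih => exact (hlink ⟨k, by omega⟩).symm.trans (ih (by omega))
  rw [hzero i i.2, hzero i' i'.2]

/-- if every link index occurs infinitely often in the update
sequence `σ`, then the asynchronous weighted-consensus iterates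
`e (k+1) = P_{σ k} ⬝ e k` converge to the constant vector whose entries are the
`v`-weighted average of the initial entries. -/
theorem weighted_consensus_convergence
    {n : ℕ} (hn : 2 ≤ n) (v : Fin n → ℝ) (hv : ∀ i, 0 < v i)
    (σ : ℕ → Fin (n - 1))
    (hσ : ∀ j : Fin (n - 1), ∀ N : ℕ, ∃ k, N ≤ k ∧ σ k = j)
    (e : ℕ → Fin n → ℝ)
    (he : ∀ k, e (k + 1) = (perronMatrix v (σ k)).mulVec (e k)) :
    Tendsto e atTop
      (nhds fun _ => (∑ j, v j * e 0 j) / ∑ j, v j) := by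
  obtain ⟨z, hfix, hz⟩ := exists_tendsto_common_fixedPoint
    (T := fun j y => perronMatrix v j *ᵥ y) (p := 0) (dist_perronMatrix_mulVec_le hv)
    (fun j => mulVec_zero _) hσ he (tendsto_dist_perronMatrix_orbit hv he)
  have hsum : ∀ k, ∑ j, v j * e k j = ∑ j, v j * e 0 j := by
    intro k
    induction k with
    | zero => rfl
    | succ k ih => rw [he, sum_mul_perronMatrix_mulVec hv, ih]
  have hlim : Tendsto (fun k => ∑ j, v j * e k j) atTop (nhds (∑ j, v j * z j)) :=
    tendsto_finsetSum _ fun j _ => (tendsto_pi_nhds.1 hz j).const_mul (v j)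
  simp only [hsum] at hlim
  have hinv := tendsto_nhds_unique hlim tendsto_const_nhds
  suffices hconst : (fun _ => (∑ j, v j * e 0 j) / ∑ j, v j) = z from hconst ▸ hz
  funext i
  have hpos : 0 < ∑ j, v j := Finset.sum_pos (fun j _ => hv j) ⟨i, Finset.mem_univ i⟩
  rw [← hinv, div_eq_iff hpos.ne', Finset.mul_sum]
  exact Finset.sum_congr rfl fun j _ => by
    rw [eq_of_perronMatrix_mulVec_eq hfix j i, mul_comm]
end

section
/- Fix an integer n ≥ 2 and an orientation word o : ZMod n → ℤ with o(i) ∈ {−1, 1} for all i, and let F be the round map. Then Σ_{i} (F o)(i) = Σ_{i} o(i); consequently the number of indices with value +1 and the number with value −1 are both preserved: n₊(F o) = n₊(o) and n₋(F o) = n₋(o). -/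
/-- `i` is a meeting index of the orientation word `o`: `o i = 1` and
`o (i+1) = -1`. -/
def IsMeeting {n : ℕ} (o : ZMod n → ℤ) (i : ZMod n) : Prop :=
  o i = 1 ∧ o (i + 1) = -1

instance {n : ℕ} (o : ZMod n → ℤ) (i : ZMod n) : Decidable (IsMeeting o i) := by
  unfold IsMeeting; infer_instance

/-- The round map `F`: each adjacent pair oriented `(+1, -1)` meets and both
members reverse their orientation; all other orientations are unchanged. -/
def roundMap {n : ℕ} (o : ZMod n → ℤ) : ZMod n → ℤ := fun i =>
  if IsMeeting o i then -1
  else if IsMeeting o (i - 1) then 1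
  else o i

/-- The set of meeting indices of `o`. -/
def meetSet {n : ℕ} [NeZero n] (o : ZMod n → ℤ) : Finset (ZMod n) :=
  Finset.univ.filter (IsMeeting o)

/-- The number of indices with orientation `+1`. -/
def nPlus {n : ℕ} [NeZero n] (o : ZMod n → ℤ) : ℕ :=
  (Finset.univ.filter (fun i => o i = 1)).card

/-- The number of indices with orientation `-1`. -/
def nMinus {n : ℕ} [NeZero n] (o : ZMod n → ℤ) : ℕ :=
  (Finset.univ.filter (fun i => o i = -1)).card

/-- `n_bal = min(n₊, n₋)`. -/
def nBal {n : ℕ} [NeZero n] (o : ZMod n → ℤ) : ℕ :=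
  min (nPlus o) (nMinus o)

/-- An orientation word is interlaced when its number of meeting indices equals
`n_bal`. -/
def IsInterlaced {n : ℕ} [NeZero n] (o : ZMod n → ℤ) : Prop :=
  (meetSet o).card = nBal o

/-- The round map moves one unit of orientation across each meeting pair, so it changes the word
by a discrete difference. -/
theorem roundMap_eq_add_sub {n : ℕ} (o : ZMod n → ℤ) (i : ZMod n) :
    roundMap o i =
      o i + ((if IsMeeting o (i - 1) then 2 else 0) - (if IsMeeting o i then 2 else 0)) := by
  simp only [roundMap, IsMeeting, sub_add_cancel]
  grind

theorem sum_roundMap {n : ℕ} [NeZero n] (o : ZMod n → ℤ) :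
    ∑ i, roundMap o i = ∑ i, o i := by
  simp only [roundMap_eq_add_sub, Finset.sum_add_distrib, Finset.sum_sub_distrib]
  have h := Equiv.sum_comp (Equiv.subRight (1 : ZMod n))
    (fun i => if IsMeeting o i then (2 : ℤ) else 0)
  simp only [Equiv.subRight_apply] at h
  rw [h, sub_self, add_zero]

theorem roundMap_eq_neg_one_or_one {n : ℕ} {o : ZMod n → ℤ} (ho : ∀ i, o i = -1 ∨ o i = 1)
    (i : ZMod n) : roundMap o i = -1 ∨ roundMap o i = 1 := by
  unfold roundMap
  split_ifs <;> simp [ho i]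

theorem two_mul_nPlus {n : ℕ} [NeZero n] {o : ZMod n → ℤ} (ho : ∀ i, o i = -1 ∨ o i = 1) :
    2 * (nPlus o : ℤ) = n + ∑ i, o i := by
  have h (i : ZMod n) : o i = 2 * (if o i = 1 then 1 else 0) - 1 := by
    rcases ho i with h | h <;> simp [h]
  rw [Finset.sum_congr rfl fun i _ => h i, Finset.sum_sub_distrib, ← Finset.mul_sum,
    Finset.sum_boole]
  simp [nPlus, ZMod.card]

theorem two_mul_nMinus {n : ℕ} [NeZero n] {o : ZMod n → ℤ} (ho : ∀ i, o i = -1 ∨ o i = 1) :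
    2 * (nMinus o : ℤ) = n - ∑ i, o i := by
  have h (i : ZMod n) : o i = 1 - 2 * (if o i = -1 then 1 else 0) := by
    rcases ho i with h | h <;> simp [h]
  rw [Finset.sum_congr rfl fun i _ => h i, Finset.sum_sub_distrib, ← Finset.mul_sum,
    Finset.sum_boole]
  simp [nMinus, ZMod.card]

/-- one round of the meeting dynamics preserves the sum of the
orientations, and hence the number of `+1`'s and the number of `-1`'s. -/
theorem roundMap_preserves_counts {n : ℕ} (hn : 2 ≤ n) [NeZero n]
    (o : ZMod n → ℤ) (ho : ∀ i, o i = -1 ∨ o i = 1) :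
    (∑ i, roundMap o i = ∑ i, o i) ∧
    nPlus (roundMap o) = nPlus o ∧ nMinus (roundMap o) = nMinus o := by
  have hsum := sum_roundMap o
  have hF := roundMap_eq_neg_one_or_one ho
  have hp := two_mul_nPlus ho
  have hp' := two_mul_nPlus hF
  have hm := two_mul_nMinus ho
  have hm' := two_mul_nMinus hF
  refine ⟨hsum, ?_, ?_⟩ <;> lia
end

section
/- Fix an integer n ≥ 2 and an orientation word o : ZMod n → ℤ with o(i) ∈ {−1, 1} for all i, satisfying n₊(o) ≥ n₋(o) ≥ 1. Suppose o is interlaced, i.e. its set S of meeting indices has cardinality n_bal(o) = n₋(o). Then the set of meeting indices of F o is exactly {i − 1 : i ∈ S}; in particular F o is again interlaced, with the same number n_bal(o) of meeting indices, shifted one position to the left. -/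
/-- If there are as many meeting indices as indices oriented `-1`, then every index oriented `-1`
is preceded by a meeting index. -/
theorem isMeeting_sub_one_of_card_meetSet {n : ℕ} [NeZero n] {o : ZMod n → ℤ}
    (h : (meetSet o).card = nMinus o) {j : ZMod n} (hj : o j = -1) : IsMeeting o (j - 1) := by
  have hsub : (meetSet o).image (· + 1) ⊆ Finset.univ.filter (fun i => o i = -1) := by
    intro j hj
    obtain ⟨i, hi, rfl⟩ := Finset.mem_image.1 hj
    simpa using (Finset.mem_filter.1 hi).2.2
  have heq := Finset.eq_of_subset_of_card_le hsub
    (by rw [Finset.card_image_of_injective _ (add_left_injective 1), h, nMinus])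
  have hmem : j ∈ (meetSet o).image (· + 1) := by simp [heq, hj]
  obtain ⟨i, hi, rfl⟩ := Finset.mem_image.1 hmem
  simpa [meetSet] using hi

/-- If every index oriented `-1` is preceded by a meeting index, then after one round exactly the
former meeting indices are oriented `-1`. -/
theorem roundMap_eq_ite {n : ℕ} {o : ZMod n → ℤ} (ho : ∀ i, o i = -1 ∨ o i = 1)
    (h : ∀ j, o j = -1 → IsMeeting o (j - 1)) (i : ZMod n) :
    roundMap o i = if IsMeeting o i then -1 else 1 := by
  unfold roundMap
  split_ifs with h₁ h₂
  · rfl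
  · rfl
  · exact (ho i).resolve_left fun hi => h₂ (h i hi)

theorem IsMeeting.not_isMeeting_of_add_one {n : ℕ} {o : ZMod n → ℤ} {i : ZMod n}
    (h : IsMeeting o (i + 1)) : ¬ IsMeeting o i := by
  rintro ⟨-, hi⟩
  have := h.1
  omega

theorem card_meetSet_le_nPlus {n : ℕ} [NeZero n] (o : ZMod n → ℤ) :
    (meetSet o).card ≤ nPlus o :=
  Finset.card_le_card (Finset.monotone_filter_right _ fun _ _ hi => hi.1)

/-- if `o` is interlaced (with `n₊(o) ≥ n₋(o) ≥ 1`), then the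
meeting indices of `F o` are exactly those of `o` shifted one position to the
left; in particular `F o` is again interlaced. -/
theorem roundMap_interlaced_shift {n : ℕ} (hn : 2 ≤ n) [NeZero n]
    (o : ZMod n → ℤ) (ho : ∀ i, o i = -1 ∨ o i = 1)
    (hbal : nMinus o ≤ nPlus o) (hpos : 1 ≤ nMinus o)
    (hint : (meetSet o).card = nBal o) :
    meetSet (roundMap o) = (meetSet o).image (fun i => i - 1) ∧
    IsInterlaced (roundMap o) := by
  have hround := roundMap_eq_ite ho fun j hj =>
    isMeeting_sub_one_of_card_meetSet (hint.trans (min_eq_right hbal)) hj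
  have hneg (i : ZMod n) : roundMap o i = -1 ↔ IsMeeting o i := by
    rw [hround]; split_ifs with hi <;> simp [hi]
  have hmeet (i : ZMod n) : IsMeeting (roundMap o) i ↔ IsMeeting o (i + 1) := by
    rw [IsMeeting, hneg, and_iff_right_iff_imp]
    intro hi
    rw [hround, if_neg hi.not_isMeeting_of_add_one]
  have hshift : meetSet (roundMap o) = (meetSet o).image (fun i => i - 1) := by
    ext i
    simp [meetSet, hmeet, sub_eq_iff_eq_add]
  have hminus : nMinus (roundMap o) = (meetSet (roundMap o)).card := by
    rw [hshift, Finset.card_image_of_injective _ (sub_left_injective)]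
    simp [nMinus, meetSet, hneg]
  refine ⟨hshift, ?_⟩
  rw [IsInterlaced, nBal, hminus, min_eq_right (card_meetSet_le_nPlus _)]
end

section
/- Fix an integer n ≥ 2 and an orientation word o : ZMod n → ℤ with o(i) ∈ {−1, 1} for all i, satisfying n₊(o) ≥ n₋(o) ≥ 1, and suppose o is interlaced with meeting-index set S of cardinality n_bal(o) = n₋(o). Then for every m ≥ 0 the iterate Fᵐ o is interlaced and its set of meeting indices equals {i − m : i ∈ S}. Consequently, at every round there are exactly n_bal(o) meetings, and for every fixed index i and every K ≥ 0, the number of rounds m ∈ {K, K+1, …, K+n−1} for which i is a meeting index of Fᵐ o equals n_bal(o): each boundary hosts exactly n_bal(o) meetings in every n consecutive rounds. -/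
/-- If the number of meetings is the number of `-1` entries, every `-1` is preceded by a `1`. -/
theorem eq_one_of_add_one_eq_neg_one {n : ℕ} [NeZero n] {o : ZMod n → ℤ}
    (h : (meetSet o).card = nMinus o) {i : ZMod n} (hi : o (i + 1) = -1) : o i = 1 := by
  have hsub : (meetSet o).image (· + 1) ⊆ Finset.univ.filter (fun i => o i = -1) := by
    intro j hj
    obtain ⟨k, hk, rfl⟩ := Finset.mem_image.1 hj
    simpa using (Finset.mem_filter.1 hk).2.2
  have heq := Finset.eq_of_subset_of_card_le hsub
    (by rw [Finset.card_image_of_injective _ (add_left_injective 1), h, nMinus])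
  have hmem : i + 1 ∈ (meetSet o).image (· + 1) := by simpa [heq] using hi
  obtain ⟨k, hk, hki⟩ := Finset.mem_image.1 hmem
  obtain rfl : k = i := add_right_cancel hki
  exact (Finset.mem_filter.1 hk).2.1

/-- On words in which every `-1` is preceded by a `1`, the round map is the left shift. -/
theorem roundMap_eq_shift {n : ℕ} {o : ZMod n → ℤ} (ho : ∀ i, o i = -1 ∨ o i = 1)
    (hsep : ∀ i, o (i + 1) = -1 → o i = 1) : roundMap o = fun i => o (i + 1) := by
  funext i
  have h₁ := ho i
  have h₂ := ho (i + 1)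
  have h₃ := hsep i
  have h₄ := hsep (i - 1)
  simp only [roundMap, IsMeeting, sub_add_cancel] at h₄ ⊢
  grind

theorem roundMap_iterate_eq_shift {n : ℕ} {o : ZMod n → ℤ} (ho : ∀ i, o i = -1 ∨ o i = 1)
    (hsep : ∀ i, o (i + 1) = -1 → o i = 1) (m : ℕ) :
    roundMap^[m] o = fun i => o (i + m) := by
  induction m with
  | zero => simp
  | succ m ih =>
    rw [Function.iterate_succ_apply', ih, roundMap_eq_shift (fun i => ho _)]
    · funext i
      push_cast
      congr 1
      ring
    · intro i hi
      exact hsep _ (by rwa [add_right_comm] at hi)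

theorem isMeeting_shift {n : ℕ} (o : ZMod n → ℤ) (a i : ZMod n) :
    IsMeeting (fun j => o (j + a)) i ↔ IsMeeting o (i + a) := by
  simp only [IsMeeting, add_right_comm]

theorem meetSet_shift {n : ℕ} [NeZero n] (o : ZMod n → ℤ) (a : ZMod n) :
    meetSet (fun j => o (j + a)) = (meetSet o).image (fun i => i - a) := by
  ext i
  simp only [meetSet, Finset.mem_filter, Finset.mem_univ, true_and, Finset.mem_image,
    isMeeting_shift]
  exact ⟨fun h => ⟨i + a, h, add_sub_cancel_right i a⟩, by rintro ⟨k, hk, rfl⟩; simpa using hk⟩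

theorem card_filter_shift {n : ℕ} [NeZero n] (p : ZMod n → Prop) [DecidablePred p] (a : ZMod n) :
    (Finset.univ.filter (fun i => p (i + a))).card = (Finset.univ.filter p).card :=
  Finset.card_equiv (Equiv.addRight a) (by simp)

theorem nBal_shift {n : ℕ} [NeZero n] (o : ZMod n → ℤ) (a : ZMod n) :
    nBal (fun j => o (j + a)) = nBal o := by
  simp only [nBal, nPlus, nMinus, card_filter_shift (fun i => o i = 1),
    card_filter_shift (fun i => o i = -1)]

/-- A window of `n` consecutive naturals represents every residue class exactly once. -/
theorem card_filter_Ico_natCast {n : ℕ} [NeZero n] (p : ZMod n → Prop) [DecidablePred p] (K : ℕ) :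
    ((Finset.Ico K (K + n)).filter (fun m : ℕ => p (m : ZMod n))).card
      = (Finset.univ.filter p).card := by
  refine Finset.card_nbij (fun m : ℕ => (m : ZMod n)) (fun m hm => by simp_all) ?_ ?_
  · intro a ha b hb hab
    simp only [Finset.coe_filter, Finset.mem_Ico, Set.mem_ofPred_eq] at ha hb
    have hmod : a ≡ b [MOD n] := (ZMod.natCast_eq_natCast_iff a b n).1 hab
    exact Nat.ModEq.eq_of_abs_lt hmod (by rw [abs_lt]; omega)
  · intro x hx
    have hcast : ((K + (x - K).val : ℕ) : ZMod n) = x := by simp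
    refine ⟨K + (x - K).val, ?_, hcast⟩
    have hlt := ZMod.val_lt (x - (K : ZMod n))
    simp only [Finset.coe_filter, Finset.mem_Ico, Set.mem_ofPred_eq, Finset.mem_univ,
      true_and] at hx ⊢
    exact ⟨by omega, by rwa [hcast]⟩

/-- if `o` is interlaced (with `n₊(o) ≥ n₋(o) ≥ 1`), then every
iterate `Fᵐ o` is interlaced with meeting set the meeting set of `o` shifted `m`
positions to the left; in particular every round has exactly `n_bal(o)`
meetings, and every fixed boundary hosts exactly `n_bal(o)` meetings in any `n`
consecutive rounds. -/
theorem roundMap_iterate_interlaced {n : ℕ} (hn : 2 ≤ n) [NeZero n]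
    (o : ZMod n → ℤ) (ho : ∀ i, o i = -1 ∨ o i = 1)
    (hbal : nMinus o ≤ nPlus o) (hpos : 1 ≤ nMinus o)
    (hint : (meetSet o).card = nBal o) :
    (∀ m : ℕ, IsInterlaced (roundMap^[m] o) ∧
      meetSet (roundMap^[m] o) = (meetSet o).image (fun i => i - (m : ZMod n)) ∧
      (meetSet (roundMap^[m] o)).card = nBal o) ∧
    ∀ (i : ZMod n) (K : ℕ),
      ((Finset.Ico K (K + n)).filter
        (fun m => IsMeeting (roundMap^[m] o) i)).card = nBal o := by
  have hsep : ∀ i, o (i + 1) = -1 → o i = 1 := fun i =>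
    eq_one_of_add_one_eq_neg_one (hint.trans (min_eq_right hbal))
  simp only [IsInterlaced, roundMap_iterate_eq_shift ho hsep, nBal_shift, meetSet_shift,
    Finset.card_image_of_injective _ (sub_left_injective), hint, isMeeting_shift, true_and,
    and_true, implies_true]
  intro i K
  rw [card_filter_Ico_natCast (fun a => IsMeeting o (i + a)), ← hint]
  simp only [add_comm i]
  exact card_filter_shift (IsMeeting o) i
end

section
/- Fix an even integer n ≥ 2 and an orientation word o : ZMod n → ℤ with o(i) ∈ {−1, 1} for all i, satisfying n₊(o) = n₋(o) = n/2 (balanced orientations). Then there exists K < n/2 such that for every k ≥ K the iterate Fᵏ o is fully alternating: (Fᵏ o)(i+1) = −(Fᵏ o)(i) for every i ∈ ZMod n. -/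
/-- `h` is a height function of the word `o`: its discrete derivative is `o`. -/
def IsHeight {n : ℕ} (h o : ZMod n → ℤ) : Prop := ∀ i, h (i + 1) = h i + o i

/-- The effect of `roundMap` on height functions. -/
def heightMap {n : ℕ} (h : ZMod n → ℤ) : ZMod n → ℤ := fun i =>
  max (h (i - 1)) (h (i + 1)) - 1

theorem IsHeight.heightMap_roundMap {n : ℕ} {h o : ZMod n → ℤ} (hh : IsHeight h o)
    (ho : ∀ i, o i = -1 ∨ o i = 1) : IsHeight (heightMap h) (roundMap o) := by
  intro i
  have h₀ := hh (i - 1)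
  have h₁ := hh i
  have h₂ := hh (i + 1)
  have e₁ : i + 1 - 1 = i := by ring
  have e₂ : i - 1 + 1 = i := by ring
  simp only [heightMap, roundMap, IsMeeting, e₁, e₂] at *
  rcases ho (i - 1) with a | a <;> rcases ho i with b | b <;> rcases ho (i + 1) with c | c <;>
    simp only [a, b, c] at * <;> norm_num <;> omega

theorem IsHeight.iterate {n : ℕ} {h o : ZMod n → ℤ} (hh : IsHeight h o)
    (ho : ∀ i, o i = -1 ∨ o i = 1) (k : ℕ) : IsHeight (heightMap^[k] h) (roundMap^[k] o) := by
  induction k generalizing h o with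
  | zero => exact hh
  | succ k ih => exact ih (hh.heightMap_roundMap ho) (roundMap_eq_neg_one_or_one ho)

theorem le_heightMap_iterate {n : ℕ} (h : ZMod n → ℤ) (k : ℕ) (i : ZMod n) {d : ℕ} (hd : d ≤ k) :
    h (i - k + 2 * d) ≤ heightMap^[k] h i + k := by
  induction k generalizing i d with
  | zero =>
    obtain rfl : d = 0 := by omega
    simp
  | succ k ih =>
    rw [Function.iterate_succ_apply', heightMap]
    push_cast
    rcases Nat.lt_or_ge k d with hkd | hkd
    · have := ih (i + 1) (d := d - 1) (by omega)
      rw [show i + 1 - k + 2 * ((d - 1 : ℕ) : ZMod n) = i - (k + 1) + 2 * d by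
        rw [Nat.cast_sub (by omega)]; push_cast; ring] at this
      omega
    · have := ih (i - 1) hkd
      rw [show i - 1 - k + 2 * (d : ZMod n) = i - (k + 1) + 2 * d by ring] at this
      omega

theorem exists_heightMap_iterate_eq {n : ℕ} (h : ZMod n → ℤ) (k : ℕ) (i : ZMod n) :
    ∃ d ≤ k, heightMap^[k] h i + k = h (i - k + 2 * d) := by
  induction k generalizing i with
  | zero => exact ⟨0, le_rfl, by simp⟩
  | succ k ih =>
    rw [Function.iterate_succ_apply', heightMap]
    push_cast
    rcases le_total (heightMap^[k] h (i - 1)) (heightMap^[k] h (i + 1)) with hle | hle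
    · obtain ⟨d, hd, e⟩ := ih (i + 1)
      refine ⟨d + 1, by omega, ?_⟩
      rw [max_eq_right hle, sub_add_add_cancel, e]
      congr 1
      push_cast
      ring
    · obtain ⟨d, hd, e⟩ := ih (i - 1)
      refine ⟨d, by omega, ?_⟩
      rw [max_eq_left hle, sub_add_add_cancel, e]
      congr 1
      ring

/-- After `n / 2 - 1` rounds the maxima defining the height range over a full parity class. -/
theorem heightMap_iterate_add_two {n : ℕ} (hn : 2 ≤ n) (hev : Even n) (h : ZMod n → ℤ) {k : ℕ}
    (hk : n / 2 - 1 ≤ k) (i : ZMod n) : heightMap^[k] h (i + 2) = heightMap^[k] h i := by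
  obtain ⟨m, rfl⟩ := hev
  have hm : (m : ZMod (m + m)) + m = 0 := by exact_mod_cast ZMod.natCast_self (m + m)
  apply le_antisymm
  · obtain ⟨d, hd, e⟩ := exists_heightMap_iterate_eq h k (i + 2)
    obtain ⟨d', hd', e'⟩ : ∃ d' ≤ k,
        i - k + 2 * (d' : ZMod (m + m)) = i + 2 - k + 2 * d := by
      rcases hd.eq_or_lt with rfl | hlt
      · refine ⟨d + 1 - m, by omega, ?_⟩
        rw [Nat.cast_sub (by omega)]
        push_cast
        linear_combination -hm
      · exact ⟨d + 1, hlt, by push_cast; ring⟩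
    have := le_heightMap_iterate h k i hd'
    rw [e'] at this
    omega
  · obtain ⟨d, hd, e⟩ := exists_heightMap_iterate_eq h k i
    obtain ⟨d', hd', e'⟩ : ∃ d' ≤ k,
        i + 2 - k + 2 * (d' : ZMod (m + m)) = i - k + 2 * d := by
      rcases Nat.eq_zero_or_pos d with rfl | hpos
      · refine ⟨m - 1, by omega, ?_⟩
        rw [Nat.cast_sub (by omega)]
        push_cast
        linear_combination hm
      · refine ⟨d - 1, by omega, ?_⟩
        rw [Nat.cast_sub (by omega)]
        push_cast
        ring
    have := le_heightMap_iterate h k (i + 2) hd'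
    rw [e'] at this
    omega

theorem exists_isHeight {n : ℕ} [NeZero n] (o : ZMod n → ℤ) (hsum : ∑ i, o i = 0) :
    ∃ h, IsHeight h o := by
  have hrange : ∑ m ∈ Finset.range n, o m = 0 := by
    rw [← hsum]
    refine Finset.sum_bij' (fun m _ => (m : ZMod n)) (fun i _ => i.val) ?_ ?_ ?_ ?_ ?_
    · simp
    · intro i _
      exact Finset.mem_range.2 i.val_lt
    · intro m hm
      exact ZMod.val_cast_of_lt (Finset.mem_range.1 hm)
    · simp
    · simp
  refine ⟨fun i => ∑ m ∈ Finset.range i.val, o m, fun i => ?_⟩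
  have hs : ∑ m ∈ Finset.range (i.val + 1), o m = ∑ m ∈ Finset.range i.val, o m + o i := by
    rw [Finset.sum_range_succ, ZMod.natCast_zmod_val]
  have hi : ((i.val + 1 : ℕ) : ZMod n) = i + 1 := by simp
  simp only
  rw [← hs, ← hi]
  rcases (Nat.succ_le_of_lt i.val_lt).eq_or_lt with heq | hlt
  · rw [show i.val + 1 = n from heq, ZMod.natCast_self, hrange]
    simp
  · rw [ZMod.val_cast_of_lt hlt]

theorem sum_eq_nPlus_sub_nMinus {n : ℕ} [NeZero n] (o : ZMod n → ℤ)
    (ho : ∀ i, o i = -1 ∨ o i = 1) : ∑ i, o i = (nPlus o : ℤ) - nMinus o := by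
  simp only [nPlus, nMinus, Finset.card_filter, Nat.cast_sum, ← Finset.sum_sub_distrib]
  refine Finset.sum_congr rfl fun i _ => ?_
  rcases ho i with e | e <;> simp [e]

/-- for balanced orientations (`n₊ = n₋ = n/2`, `n` even), after
fewer than `n/2` rounds every iterate of the round map is fully alternating. -/
theorem roundMap_balanced_alternating {n : ℕ} (hn : 2 ≤ n) (hev : Even n)
    [NeZero n] (o : ZMod n → ℤ) (ho : ∀ i, o i = -1 ∨ o i = 1)
    (hplus : nPlus o = n / 2) (hminus : nMinus o = n / 2) :
    ∃ K, K < n / 2 ∧ ∀ k, K ≤ k →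
      ∀ i : ZMod n, (roundMap^[k] o) (i + 1) = -((roundMap^[k] o) i) := by
  obtain ⟨h, hh⟩ := exists_isHeight o (by
    rw [sum_eq_nPlus_sub_nMinus o ho, hplus, hminus, sub_self])
  refine ⟨n / 2 - 1, by omega, fun k hk i => ?_⟩
  have h₁ := hh.iterate ho k i
  have h₂ := hh.iterate ho k (i + 1)
  rw [add_assoc, one_add_one_eq_two, heightMap_iterate_add_two hn hev h hk i] at h₂
  omega
end

section
/- (Expand rule) Fix an integer n ≥ 2, an orientation word o : ZMod n → ℤ with o(i) ∈ {−1, 1}, an index j ∈ ZMod n, and an even integer l with 2 ≤ l and l + 2 ≤ n. Suppose o(j−1) = 1, o(j+m) = (−1)ᵐ for m = 0,…,l−1 (an alternating sequence of length l starting with +1 at position j), and o(j+l) = −1. Then F o is alternating of length l+2 starting at position j−1: (F o)(j−1+m) = (−1)ᵐ for m = 0,…,l+1. -/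
/-- Expand rule: `+ [seq, l] -` becomes `[seq, l+2]` under one
round of the dynamics. -/
theorem roundMap_expand_rule {n : ℕ} (hn : 2 ≤ n) [NeZero n]
    (o : ZMod n → ℤ) (ho : ∀ i, o i = -1 ∨ o i = 1)
    (j : ZMod n) (l : ℕ) (hl2 : 2 ≤ l) (hle : Even l) (hln : l + 2 ≤ n)
    (hleft : o (j - 1) = 1)
    (hseq : ∀ m : ℕ, m < l → o (j + (m : ZMod n)) = (-1) ^ m)
    (hright : o (j + (l : ZMod n)) = -1) :
    ∀ m : ℕ, m < l + 2 → roundMap o (j - 1 + (m : ZMod n)) = (-1) ^ m := by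
  have hfirst : o j = 1 := by simpa using hseq 0 (by omega)
  intro m hm
  rcases m with _ | k
  · have h : j - 1 + 1 = j := by ring
    have h' : j - 1 - 1 + 1 = j - 1 := by ring
    simp [roundMap, IsMeeting, h, h', hleft, hfirst]
  have hpos : j - 1 + ((k + 1 : ℕ) : ZMod n) = j + (k : ZMod n) := by push_cast; ring
  rw [hpos]
  obtain rfl | hk : k = l ∨ k < l := by omega
  · obtain ⟨p, rfl⟩ : ∃ p, k = p + 1 := ⟨k - 1, by omega⟩
    have hp : Odd p := by
      rw [← Nat.not_even_iff_odd]
      exact Nat.even_add_one.mp hle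
    have hprev : o (j + ((p + 1 : ℕ) : ZMod n) - 1) = -1 := by
      have h : j + ((p + 1 : ℕ) : ZMod n) - 1 = j + (p : ZMod n) := by push_cast; ring
      rw [h, hseq p (by omega), hp.neg_one_pow]
    rw [hle.add_one.neg_one_pow]
    simp only [roundMap, IsMeeting, hright, hprev]
    norm_num
  · rcases Nat.even_or_odd k with hk' | hk'
    · have hcur : o (j + (k : ZMod n)) = 1 := by rw [hseq k hk, hk'.neg_one_pow]
      have hnext : o (j + (k : ZMod n) + 1) = -1 := by
        have h : j + (k : ZMod n) + 1 = j + ((k + 1 : ℕ) : ZMod n) := by push_cast; ring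
        rw [h, hseq (k + 1) (by grind), hk'.add_one.neg_one_pow]
      rw [hk'.add_one.neg_one_pow]
      simp [roundMap, IsMeeting, hcur, hnext]
    · have hcur : o (j + (k : ZMod n)) = -1 := by rw [hseq k hk, hk'.neg_one_pow]
      obtain ⟨p, rfl⟩ : ∃ p, k = p + 1 := ⟨k - 1, by grind⟩
      have hp : Even p := by grind
      have hprev : o (j + ((p + 1 : ℕ) : ZMod n) - 1) = 1 := by
        have h : j + ((p + 1 : ℕ) : ZMod n) - 1 = j + (p : ZMod n) := by push_cast; ring
        rw [h, hseq p (by omega), hp.neg_one_pow]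
      rw [hk'.add_one.neg_one_pow]
      simp only [roundMap, IsMeeting, hcur, hprev, sub_add_cancel]
      norm_num
end

section
/- (Reduce rule) Fix an integer n ≥ 2, an orientation word o : ZMod n → ℤ with o(i) ∈ {−1, 1}, an index j ∈ ZMod n, and an even integer l with 2 ≤ l and l + 2 ≤ n. Suppose o(j−1) = −1, o(j+m) = (−1)ᵐ for m = 0,…,l−1 (an alternating sequence of length l starting with +1 at position j), and o(j+l) = 1. Then (F o)(j) = −1, (F o)(j+1+m) = (−1)ᵐ for m = 0,…,l−3 (an alternating sequence of length l−2 starting at position j+1), and (F o)(j+l−1) = 1. -/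
theorem roundMap_of_isMeeting {n : ℕ} {o : ZMod n → ℤ} {i : ZMod n}
    (h : IsMeeting o i) : roundMap o i = -1 :=
  if_pos h

theorem roundMap_add_one_of_isMeeting {n : ℕ} {o : ZMod n → ℤ} {i : ZMod n}
    (h : IsMeeting o i) : roundMap o (i + 1) = 1 := by
  have hnot : ¬ IsMeeting o (i + 1) := fun h' => by
    have := h.2.symm.trans h'.1
    norm_num at this
  simp [roundMap, hnot, h]

theorem isMeeting_of_alternating {n : ℕ} {o : ZMod n → ℤ} {j : ZMod n} {l : ℕ}
    (hseq : ∀ m : ℕ, m < l → o (j + (m : ZMod n)) = (-1) ^ m)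
    {m : ℕ} (hm : Even m) (hml : m + 1 < l) : IsMeeting o (j + (m : ZMod n)) := by
  refine ⟨by rw [hseq m (by omega), hm.neg_one_pow], ?_⟩
  have h := hseq (m + 1) hml
  rwa [hm.add_one.neg_one_pow, Nat.cast_add_one, ← add_assoc] at h

/-- Reduce rule: `- [seq, l] +` becomes `- - [seq, l-2] + +`
under one round of the dynamics. -/
theorem roundMap_reduce_rule {n : ℕ} (hn : 2 ≤ n) [NeZero n]
    (o : ZMod n → ℤ) (ho : ∀ i, o i = -1 ∨ o i = 1)
    (j : ZMod n) (l : ℕ) (hl2 : 2 ≤ l) (hle : Even l) (hln : l + 2 ≤ n)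
    (hleft : o (j - 1) = -1)
    (hseq : ∀ m : ℕ, m < l → o (j + (m : ZMod n)) = (-1) ^ m)
    (hright : o (j + (l : ZMod n)) = 1) :
    roundMap o j = -1 ∧
    (∀ m : ℕ, m < l - 2 → roundMap o (j + 1 + (m : ZMod n)) = (-1) ^ m) ∧
    roundMap o (j + (l : ZMod n) - 1) = 1 := by
  have hmeet {m : ℕ} := isMeeting_of_alternating hseq (m := m)
  refine ⟨?_, fun m hm => ?_, ?_⟩
  · simpa using roundMap_of_isMeeting (hmeet Even.zero (by omega))
  · rcases Nat.even_or_odd m with he | hodd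
    · rw [he.neg_one_pow, add_right_comm]
      exact roundMap_add_one_of_isMeeting (hmeet he (by omega))
    · have h := roundMap_of_isMeeting (hmeet hodd.add_one (by omega))
      rwa [hodd.neg_one_pow, add_assoc, add_comm (1 : ZMod n), ← Nat.cast_add_one]
  · obtain ⟨k, rfl⟩ := Nat.exists_eq_add_of_le' hl2
    have hk : Even k := by simpa [Nat.even_add] using hle
    convert roundMap_add_one_of_isMeeting (hmeet hk (by omega)) using 2
    push_cast
    ring
end

section
/- Let n ≥ 2 be an even integer, c a real number, and t₀ : ZMod n → ℝ an assignment of initial event times. For i ∈ ZMod n and k ∈ ℕ, define the partner p(i,k) = i+1 if i+k is even (i.e. the image of i+k in ZMod 2 is 0) and p(i,k) = i−1 otherwise, and define iteratively t_{k+1}(i) = max(t_k(i), t_k(p(i,k))) + c. Then for every k ≥ n/2 and every i ∈ ZMod n, t_k(i) = k·c + max_{j ∈ ZMod n} t₀(j): after n/2 rounds all event times synchronize and thereafter all meetings occur simultaneously, advancing by exactly c per round. -/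
lemma maxConsensus_le {ι : Type*} [Fintype ι] [Nonempty ι] (c : ℝ) (t : ℕ → ι → ℝ)
    (p : ℕ → ι → ι) (ht : ∀ k i, t (k + 1) i = max (t k i) (t k (p k i)) + c)
    (k : ℕ) (i : ι) :
    t k i ≤ (k : ℝ) * c + Finset.univ.sup' Finset.univ_nonempty (t 0) := by
  induction k generalizing i with
  | zero =>
    exact (Finset.le_sup' (t 0) (Finset.mem_univ i)).trans_eq
      (by simp only [Nat.cast_zero, zero_mul, zero_add])
  | succ k ih =>
    have h := max_le (ih i) (ih (p k i))
    rw [ht]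
    push_cast
    linarith

/-- After `m + 1` rounds, the event time at `i` dominates the initial event times over a window
of `2 * (m + 1)` consecutive indices, whose position depends on the parity of `i + m`. -/
lemma maxConsensus_window_le {n : ℕ} (φ : ZMod n →+* ZMod 2) (c : ℝ) (t : ℕ → ZMod n → ℝ)
    (ht : ∀ (k : ℕ) (i : ZMod n),
      t (k + 1) i = max (t k i) (t k (if φ (i + (k : ZMod n)) = 0 then i + 1 else i - 1)) + c)
    (m : ℕ) (i : ZMod n) (s : ℕ) (hs : s < 2 * (m + 1)) :
    ((m + 1 : ℕ) : ℝ) * c + t 0 ((if φ (i + (m : ZMod n)) = 0 then i - m else i - m - 1) + s) ≤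
      t (m + 1) i := by
  have parity : ∀ x : ZMod 2, x + 1 = 0 ↔ ¬ x = 0 := by decide
  induction m generalizing i s with
  | zero =>
    rw [ht]
    obtain rfl | rfl : s = 0 ∨ s = 1 := by omega
    all_goals
      split_ifs <;> simp [add_comm]
  | succ m ih =>
    have shift : φ (i + ((m + 1 : ℕ) : ZMod n)) = 0 ↔ ¬ φ (i + (m : ZMod n)) = 0 := by
      rw [← parity, ← map_one φ, ← map_add]
      push_cast
      rw [add_assoc]
    rw [ht (m + 1)]
    by_cases h : φ (i + (m : ZMod n)) = 0
    · have h' : ¬ φ (i + ((m + 1 : ℕ) : ZMod n)) = 0 := fun h0 => shift.1 h0 h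
      have hp : ¬ φ (i - 1 + (m : ZMod n)) = 0 := by
        rw [← parity, ← map_one φ, ← map_add, ← h]
        ring_nf
      simp only [h', if_false]
      rcases lt_or_ge s (2 * (m + 1)) with hlt | hge
      · have key := ih (i - 1) s hlt
        rw [if_neg hp] at key
        have hidx : i - 1 - (m : ZMod n) - 1 + s = i - ((m + 1 : ℕ) : ZMod n) - 1 + s := by
          push_cast; ring
        rw [hidx] at key
        have hmax := le_max_right (t (m + 1) i) (t (m + 1) (i - 1))
        push_cast at key ⊢
        linarith
      · obtain ⟨r, rfl⟩ : ∃ r, s = r + 2 := ⟨s - 2, by omega⟩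
        have key := ih i r (by omega)
        rw [if_pos h] at key
        have hidx : i - (m : ZMod n) + r = i - ((m + 1 : ℕ) : ZMod n) - 1 + (r + 2 : ℕ) := by
          push_cast; ring
        rw [hidx] at key
        have hmax := le_max_left (t (m + 1) i) (t (m + 1) (i - 1))
        push_cast at key ⊢
        linarith
    · have h' : φ (i + ((m + 1 : ℕ) : ZMod n)) = 0 := shift.2 h
      have hp : φ (i + 1 + (m : ZMod n)) = 0 := by
        rw [← h']
        push_cast
        ring_nf
      simp only [h', if_true]
      rcases lt_or_ge s (2 * (m + 1)) with hlt | hge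
      · have key := ih i s hlt
        rw [if_neg h] at key
        have hidx : i - (m : ZMod n) - 1 + s = i - ((m + 1 : ℕ) : ZMod n) + s := by
          push_cast; ring
        rw [hidx] at key
        have hmax := le_max_left (t (m + 1) i) (t (m + 1) (i + 1))
        push_cast at key ⊢
        linarith
      · obtain ⟨r, rfl⟩ : ∃ r, s = r + 2 := ⟨s - 2, by omega⟩
        have key := ih (i + 1) r (by omega)
        rw [if_pos hp] at key
        have hidx : i + 1 - (m : ZMod n) + r = i - ((m + 1 : ℕ) : ZMod n) + (r + 2 : ℕ) := by
          push_cast; ring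
        rw [hidx] at key
        have hmax := le_max_right (t (m + 1) i) (t (m + 1) (i + 1))
        push_cast at key ⊢
        linarith

/-- max-consensus synchronization of event times. On the `n`-cycle
(`n` even), each index `i` is paired at round `k` with `i+1` if `i+k` is even
(its image in `ZMod 2` is `0`) and with `i-1` otherwise, and event times update
by `t_{k+1}(i) = max(t_k(i), t_k(partner)) + c`. After `n/2` rounds all event
times equal `k·c + max_j t₀(j)`. -/
theorem max_consensus_synchronization
    {n : ℕ} (hn : 2 ≤ n) (hdvd : (2 : ℕ) ∣ n) [NeZero n]
    (c : ℝ) (t : ℕ → ZMod n → ℝ)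
    (ht : ∀ (k : ℕ) (i : ZMod n),
      t (k + 1) i =
        max (t k i)
          (t k (if (ZMod.castHom hdvd (ZMod 2)) (i + (k : ZMod n)) = 0
                then i + 1 else i - 1)) + c) :
    ∀ k, n / 2 ≤ k → ∀ i : ZMod n,
      t k i = (k : ℝ) * c + Finset.univ.sup' Finset.univ_nonempty (t 0) := by
  intro k hk i
  refine le_antisymm (maxConsensus_le c t _ ht k i) ?_
  obtain ⟨m, rfl⟩ : ∃ m, k = m + 1 := ⟨k - 1, by omega⟩
  obtain ⟨j, -, hj⟩ := Finset.exists_mem_eq_sup' Finset.univ_nonempty (t 0)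
  rw [hj]
  set φ := ZMod.castHom hdvd (ZMod 2)
  set b : ZMod n := if φ (i + (m : ZMod n)) = 0 then i - m else i - m - 1 with hb
  have hs := ZMod.val_lt (j - b)
  have h := maxConsensus_window_le φ c t ht m i (j - b).val (by omega)
  rwa [← hb, ZMod.natCast_zmod_val, add_sub_cancel] at h
end
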